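/- Fix a linear contract instance with optimal static principal utility R_⋆ := max_{1≤i≤n} (1 − α_{i−1,i})·R_i > 0 (with α_{0,1} := 0). Suppose there exists a valid dynamic linear contract π₀ with Util(π₀) > R_⋆. Then for every γ > 1 there exist ε′ > 0, finitely many valid dynamic linear contracts π_1, …, π_M all with the same total duration T, and weights λ_1, …, λ_M ≥ 0 with Σ_i λ_i = 1, such that Σ_i λ_i·u_P^{(t)}(π_i) ≥ (1 + ε′)·R_⋆·t for every t ∈ [T/γ, T]. (If any dynamic contract strictly beats the optimal static contract at a known horizon, then for any bounded time-uncertainty ratio γ a randomized dynamic contract maintains a strict multiplicative advantage over the static optimum throughout the uncertainty window.) -/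

import Mathlib

open Finset

/-- Indifference point `α_{i,i+1}` between actions `i` and `i+1`. -/
noncomputable def indiff (c R : ℕ → ℝ) (i : ℕ) : ℝ :=
  (c (i + 1) - c i) / (R (i + 1) - R i)

/-- Breakpoint `α_{i,i+1}` with the convention `α_{0,1} := 0`. -/
noncomputable def bp (c R : ℕ → ℝ) (i : ℕ) : ℝ :=
  if i = 0 then 0 else indiff c R i

/-- A linear contract instance with `n ≥ 2` actions indexed `1,…,n`:
costs `0 = c_1 < … < c_n`, rewards `0 ≤ R_1 < … < R_n`, and indifference
points satisfying `0 < α_{1,2} < … < α_{n-1,n} ≤ 1`. -/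
def LinInstance (n : ℕ) (c R : ℕ → ℝ) : Prop :=
  2 ≤ n ∧ c 1 = 0 ∧ 0 ≤ R 1 ∧
    (∀ i, 1 ≤ i → i < n → c i < c (i + 1)) ∧
    (∀ i, 1 ≤ i → i < n → R i < R (i + 1)) ∧
    0 < indiff c R 1 ∧
    (∀ i, 1 ≤ i → i + 1 ≤ n - 1 → indiff c R i < indiff c R (i + 1)) ∧
    indiff c R (n - 1) ≤ 1

/-- Best-response set of the agent to the linear contract with scalar `x`. -/
def BR (n : ℕ) (c R : ℕ → ℝ) (x : ℝ) : Set ℕ :=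
  {i | i ∈ Finset.Icc 1 n ∧ ∀ j ∈ Finset.Icc 1 n, x * R j - c j ≤ x * R i - c i}

/-- A dynamic linear contract with `K` segments (indexed `1,…,K`):
scalars `α`, durations `τ`, and actions `a`. -/
structure DLC where
  K : ℕ
  α : ℕ → ℝ
  τ : ℕ → ℝ
  a : ℕ → ℕ

namespace DLC

/-- Total duration of the first `k` segments. -/
noncomputable def Tsum (π : DLC) (k : ℕ) : ℝ := ∑ j ∈ Finset.Icc 1 k, π.τ j

/-- Cumulative scalar contract of the first `k` segments. -/
noncomputable def Asum (π : DLC) (k : ℕ) : ℝ := ∑ j ∈ Finset.Icc 1 k, π.α j * π.τ j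

/-- Time-averaged contract `ᾱ^k` after the first `k` segments. -/
noncomputable def avg (π : DLC) (k : ℕ) : ℝ := π.Asum k / π.Tsum k

/-- Validity: positive durations, nonnegative scalars, actions in `{1,…,n}`,
and each action is a best response to the historical average contract at the
end of its segment, and (for `k ≥ 2`) also at its beginning. -/
def Valid (n : ℕ) (c R : ℕ → ℝ) (π : DLC) : Prop :=
  1 ≤ π.K ∧
    (∀ k ∈ Finset.Icc 1 π.K, 0 ≤ π.α k ∧ 0 < π.τ k ∧ π.a k ∈ Finset.Icc 1 n) ∧
    (∀ k ∈ Finset.Icc 1 π.K, π.a k ∈ BR n c R (π.avg k)) ∧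
    (∀ k, 2 ≤ k → k ≤ π.K → π.a k ∈ BR n c R (π.avg (k - 1)))

/-- Time-averaged principal utility. -/
noncomputable def Util (R : ℕ → ℝ) (π : DLC) : ℝ :=
  (∑ k ∈ Finset.Icc 1 π.K, π.τ k * (1 - π.α k) * R (π.a k)) / π.Tsum π.K

/-- Time-averaged agent utility. -/
noncomputable def UtilA (c R : ℕ → ℝ) (π : DLC) : ℝ :=
  (∑ k ∈ Finset.Icc 1 π.K, π.τ k * (π.α k * R (π.a k) - c (π.a k))) / π.Tsum π.K

/-- Free-fall: the zero contract is offered on every segment after the first. -/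
def FreeFall (π : DLC) : Prop := ∀ k, 2 ≤ k → k ≤ π.K → π.α k = 0

/-- Cumulative principal utility `u_P^{(t)}(π)` up to time `t`. -/
noncomputable def cumUtil (R : ℕ → ℝ) (π : DLC) (t : ℝ) : ℝ :=
  ∑ k ∈ Finset.Icc 1 π.K,
    (min t (π.Tsum k) - min t (π.Tsum (k - 1))) * (1 - π.α k) * R (π.a k)

/-- Cumulative scalar contract `A^{(t)}` up to time `t`. -/
noncomputable def cumA (π : DLC) (t : ℝ) : ℝ :=
  ∑ k ∈ Finset.Icc 1 π.K, (min t (π.Tsum k) - min t (π.Tsum (k - 1))) * π.α k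

end DLC

namespace RAUU

lemma Rmono {n : ℕ} {c R : ℕ → ℝ} (h : LinInstance n c R) {i j : ℕ} (hi : 1 ≤ i) (hij : i ≤ j)
    (hj : j ≤ n) : R i ≤ R j := by
  induction j, hij using Nat.le_induction with
  | base => exact le_rfl
  | succ k hk ih =>
    have := h.2.2.2.2.1 k (by omega) (by omega)
    have := ih (by omega)
    linarith

lemma Imono {n : ℕ} {c R : ℕ → ℝ} (h : LinInstance n c R) {i j : ℕ} (hi : 1 ≤ i) (hij : i ≤ j)
    (hj : j < n) : indiff c R i ≤ indiff c R j := by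
  induction j, hij using Nat.le_induction with
  | base => exact le_rfl
  | succ k hk ih =>
    have := h.2.2.2.2.2.2.1 k (by omega) (by omega)
    have := ih (by omega)
    linarith

lemma Ipos {n : ℕ} {c R : ℕ → ℝ} (h : LinInstance n c R) {i : ℕ} (hi : 1 ≤ i)
    (hj : i < n) : 0 < indiff c R i :=
  lt_of_lt_of_le h.2.2.2.2.2.1 (Imono h le_rfl hi hj)

lemma Ile {n : ℕ} {c R : ℕ → ℝ} (h : LinInstance n c R) {i : ℕ} (hi : 1 ≤ i)
    (hj : i < n) : indiff c R i ≤ 1 :=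
  le_trans (Imono h hi (by omega : i ≤ n - 1) (by omega)) h.2.2.2.2.2.2.2

lemma cdiff {n : ℕ} {c R : ℕ → ℝ} (h : LinInstance n c R) {i : ℕ} (hi : 1 ≤ i)
    (hj : i < n) : c (i + 1) - c i = indiff c R i * (R (i + 1) - R i) := by
  have := h.2.2.2.2.1 i hi hj
  unfold indiff
  rw [div_mul_cancel₀]
  linarith

lemma Rnonneg {n : ℕ} {c R : ℕ → ℝ} (h : LinInstance n c R) {i : ℕ} (hi : 1 ≤ i)
    (hj : i ≤ n) : 0 ≤ R i :=
  le_trans h.2.2.1 (Rmono h le_rfl hi hj)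

lemma br_suff {n : ℕ} {c R : ℕ → ℝ} (h : LinInstance n c R) {i : ℕ} {x : ℝ} (hi : 1 ≤ i)
    (hn : i ≤ n) (h1 : 2 ≤ i → indiff c R (i - 1) ≤ x) (h2 : i < n → x ≤ indiff c R i) :
    i ∈ BR n c R x := by
  refine ⟨Finset.mem_Icc.2 ⟨hi, hn⟩, ?_⟩
  intro j hj
  obtain ⟨hj1, hjn⟩ := Finset.mem_Icc.1 hj
  rcases le_total i j with hij | hij
  · induction j, hij using Nat.le_induction with
    | base => exact le_rfl
    | succ k hk ih =>
      have e1 := ih (Finset.mem_Icc.2 ⟨by omega, by omega⟩) (by omega) (by omega)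
      have e2 := cdiff h (i := k) (by omega) (by omega)
      have e3 := Imono h hi hk (by omega)
      have e4 := h2 (by omega)
      have e5 := h.2.2.2.2.1 k (by omega) (by omega)
      nlinarith
  · -- downward
    have key : ∀ d, d < i → x * R (i - d) - c (i - d) ≤ x * R i - c i := by
      intro d
      induction d with
      | zero => intro _; simp
      | succ d ih =>
        intro hd
        have e1 := ih (by omega)
        obtain ⟨k, hk⟩ : ∃ k, i - (d + 1) = k := ⟨_, rfl⟩
        have hk' : i - d = k + 1 := by omega
        rw [hk'] at e1
        rw [hk]
        have e2 := cdiff h (i := k) (by omega) (by omega)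
        have e3 := Imono h (i := k) (j := i - 1) (by omega) (by omega) (by omega)
        have e4 := h1 (by omega)
        have e5 := h.2.2.2.2.1 k (by omega) (by omega)
        nlinarith
    have := key (i - j) (by omega)
    rwa [show i - (i - j) = j by omega] at this

lemma br_lower {n : ℕ} {c R : ℕ → ℝ} (h : LinInstance n c R) {i : ℕ} {x : ℝ}
    (hb : i ∈ BR n c R x) (h2 : 2 ≤ i) : indiff c R (i - 1) ≤ x := by
  obtain ⟨hi, hb⟩ := hb
  obtain ⟨k, rfl⟩ : ∃ k, i = k + 1 := ⟨i - 1, by omega⟩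
  obtain ⟨_, hin⟩ := Finset.mem_Icc.1 hi
  have e1 := hb k (Finset.mem_Icc.2 ⟨by omega, by omega⟩)
  have e2 := cdiff h (i := k) (by omega) (by omega)
  have e5 := h.2.2.2.2.1 k (by omega) (by omega)
  simp only [Nat.add_sub_cancel]
  by_contra hc
  push Not at hc
  nlinarith

lemma br_upper {n : ℕ} {c R : ℕ → ℝ} (h : LinInstance n c R) {i : ℕ} {x : ℝ}
    (hb : i ∈ BR n c R x) (h2 : i < n) : x ≤ indiff c R i := by
  obtain ⟨hi, hb⟩ := hb
  obtain ⟨_, hin⟩ := Finset.mem_Icc.1 hi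
  have e1 := hb (i + 1) (Finset.mem_Icc.2 ⟨by omega, by omega⟩)
  have e2 := cdiff h (i := i) (by omega) (by omega)
  have e5 := h.2.2.2.2.1 i (by omega) (by omega)
  by_contra hc
  push Not at hc
  nlinarith

lemma tsum_mono {n : ℕ} {c R : ℕ → ℝ} {π : DLC} (hv : π.Valid n c R) {k : ℕ} (hk : k ≤ π.K) :
    π.Tsum k ≤ π.Tsum π.K := by
  unfold DLC.Tsum
  apply Finset.sum_le_sum_of_subset_of_nonneg
  · exact Finset.Icc_subset_Icc le_rfl hk
  · intro i hi _
    exact (hv.2.1 i hi).2.1.le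

lemma tsum_pos {n : ℕ} {c R : ℕ → ℝ} {π : DLC} (hv : π.Valid n c R) {k : ℕ} (h1 : 1 ≤ k)
    (hk : k ≤ π.K) : 0 < π.Tsum k := by
  unfold DLC.Tsum
  apply Finset.sum_pos
  · intro i hi
    rw [Finset.mem_Icc] at hi
    exact (hv.2.1 i (Finset.mem_Icc.2 ⟨hi.1, by omega⟩)).2.1
  · exact ⟨1, Finset.mem_Icc.2 ⟨le_rfl, h1⟩⟩

lemma asum_nonneg {n : ℕ} {c R : ℕ → ℝ} {π : DLC} (hv : π.Valid n c R) :
    0 ≤ π.Asum π.K := by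
  unfold DLC.Asum
  apply Finset.sum_nonneg
  intro i hi
  exact mul_nonneg (hv.2.1 i hi).1 (hv.2.1 i hi).2.1.le

lemma tsum_succ (π : DLC) (k : ℕ) : π.Tsum (k + 1) = π.Tsum k + π.τ (k + 1) := by
  unfold DLC.Tsum
  rw [Finset.sum_Icc_succ_top (by omega)]

lemma asum_succ (π : DLC) (k : ℕ) : π.Asum (k + 1) = π.Asum k + π.α (k + 1) * π.τ (k + 1) := by
  unfold DLC.Asum
  rw [Finset.sum_Icc_succ_top (by omega)]

lemma cum_stable {n : ℕ} {c R : ℕ → ℝ} {π : DLC} (hv : π.Valid n c R) {t : ℝ}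
    (ht : π.Tsum π.K ≤ t) :
    π.cumUtil R t = ∑ k ∈ Finset.Icc 1 π.K, π.τ k * (1 - π.α k) * R (π.a k) := by
  unfold DLC.cumUtil
  apply Finset.sum_congr rfl
  intro k hk
  rw [Finset.mem_Icc] at hk
  rw [min_eq_right (le_trans (tsum_mono hv hk.2) ht),
    min_eq_right (le_trans (tsum_mono hv (by omega : k - 1 ≤ π.K)) ht)]
  obtain ⟨j, rfl⟩ : ∃ j, k = j + 1 := ⟨k - 1, by omega⟩
  rw [tsum_succ]
  simp

lemma single {n : ℕ} {c R : ℕ → ℝ} {x S : ℝ} {b : ℕ} (hx : 0 ≤ x) (hS : 0 < S)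
    (hb : b ∈ BR n c R x) :
    ∃ π : DLC, π.Valid n c R ∧ π.Tsum π.K = S ∧ π.Asum π.K = x * S ∧
      ∀ t, 0 ≤ t → t ≤ S → π.cumUtil R t = t * (1 - x) * R b := by
  refine ⟨⟨1, fun _ => x, fun _ => S, fun _ => b⟩, ⟨le_rfl, ?_, ?_, ?_⟩, ?_, ?_, ?_⟩
  · intro k _
    exact ⟨hx, hS, hb.1⟩
  · intro k hk
    have : k = 1 := by simpa using hk
    subst this
    simp [DLC.avg, DLC.Asum, DLC.Tsum]
    rwa [mul_div_cancel_right₀ _ hS.ne']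
  · intro k h2 h1
    simp at h1
    omega
  · simp [DLC.Tsum]
  · simp [DLC.Asum]
  · intro t h0 h1
    simp [DLC.cumUtil, DLC.Tsum, h0, h1]

lemma ext {n : ℕ} {c R : ℕ → ℝ} {π : DLC} (hv : π.Valid n c R) {x τ : ℝ} {b : ℕ}
    (hx : 0 ≤ x) (hτ : 0 < τ)
    (hb : b ∈ BR n c R (π.Asum π.K / π.Tsum π.K))
    (hb' : b ∈ BR n c R ((π.Asum π.K + x * τ) / (π.Tsum π.K + τ))) :
    ∃ π' : DLC, π'.Valid n c R ∧ π'.Tsum π'.K = π.Tsum π.K + τ ∧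
      π'.Asum π'.K = π.Asum π.K + x * τ ∧
      (∀ t ≤ π.Tsum π.K, π'.cumUtil R t = π.cumUtil R t) ∧
      (∀ t, π.Tsum π.K ≤ t → t ≤ π.Tsum π.K + τ →
        π'.cumUtil R t = π.cumUtil R (π.Tsum π.K) + (t - π.Tsum π.K) * (1 - x) * R b) := by
  obtain ⟨π', hπ'⟩ : ∃ π' : DLC, π' = ⟨π.K + 1, fun k => if k ≤ π.K then π.α k else x,
    fun k => if k ≤ π.K then π.τ k else τ, fun k => if k ≤ π.K then π.a k else b⟩ := ⟨_, rfl⟩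
  have hK : π'.K = π.K + 1 := by rw [hπ']
  have hα : ∀ k ≤ π.K, π'.α k = π.α k := by intro k hk; simp [hπ', hk]
  have hτ' : ∀ k ≤ π.K, π'.τ k = π.τ k := by intro k hk; simp [hπ', hk]
  have ha : ∀ k ≤ π.K, π'.a k = π.a k := by intro k hk; simp [hπ', hk]
  have hα1 : π'.α (π.K + 1) = x := by simp [hπ']
  have hτ1 : π'.τ (π.K + 1) = τ := by simp [hπ']
  have ha1 : π'.a (π.K + 1) = b := by simp [hπ']
  clear hπ'
  have hT : ∀ k ≤ π.K, π'.Tsum k = π.Tsum k := by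
    intro k hk
    apply Finset.sum_congr rfl
    intro j hj
    rw [Finset.mem_Icc] at hj
    exact hτ' j (by omega)
  have hA : ∀ k ≤ π.K, π'.Asum k = π.Asum k := by
    intro k hk
    apply Finset.sum_congr rfl
    intro j hj
    rw [Finset.mem_Icc] at hj
    rw [hτ' j (by omega), hα j (by omega)]
  have hT1 : π'.Tsum (π.K + 1) = π.Tsum π.K + τ := by
    rw [tsum_succ, hT _ le_rfl, hτ1]
  have hA1 : π'.Asum (π.K + 1) = π.Asum π.K + x * τ := by
    rw [asum_succ, hA _ le_rfl, hτ1, hα1]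
  have hcum : ∀ t, π'.cumUtil R t = π.cumUtil R t +
      (min t (π.Tsum π.K + τ) - min t (π.Tsum π.K)) * (1 - x) * R b := by
    intro t
    unfold DLC.cumUtil
    rw [hK, Finset.sum_Icc_succ_top (by omega), hT1, hα1, ha1, Nat.add_sub_cancel, hT _ le_rfl]
    congr 1
    apply Finset.sum_congr rfl
    intro k hk
    rw [Finset.mem_Icc] at hk
    rw [hT k hk.2, hT (k - 1) (by omega), hα k hk.2, ha k hk.2]
  refine ⟨π', ⟨by omega, ?_, ?_, ?_⟩, by rw [hK, hT1], by rw [hK, hA1], ?_, ?_⟩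
  · intro k hk
    rw [Finset.mem_Icc, hK] at hk
    rcases Nat.lt_or_ge π.K k with h | h
    · obtain rfl : k = π.K + 1 := by omega
      rw [hα1, hτ1, ha1]
      exact ⟨hx, hτ, hb.1⟩
    · rw [hα k h, hτ' k h, ha k h]
      exact hv.2.1 k (Finset.mem_Icc.2 ⟨hk.1, h⟩)
  · intro k hk
    rw [Finset.mem_Icc, hK] at hk
    unfold DLC.avg
    rcases Nat.lt_or_ge π.K k with h | h
    · obtain rfl : k = π.K + 1 := by omega
      rw [hA1, hT1, ha1]
      exact hb'
    · rw [hA k h, hT k h, ha k h]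
      exact hv.2.2.1 k (Finset.mem_Icc.2 ⟨hk.1, h⟩)
  · intro k h2 hk
    rw [hK] at hk
    unfold DLC.avg
    rw [hA _ (by omega), hT _ (by omega)]
    rcases Nat.lt_or_ge π.K k with h | h
    · obtain rfl : k = π.K + 1 := by omega
      rw [ha1]
      exact hb
    · rw [ha k h]
      exact hv.2.2.2 k h2 h
  · intro t ht
    rw [hcum, min_eq_left ht, min_eq_left (by linarith)]
    ring
  · intro t ht1 ht2
    rw [hcum, min_eq_left ht2, min_eq_right ht1, cum_stable hv ht1, cum_stable hv le_rfl]

/-- The claim of the theorem as a predicate. -/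
def Goal (n : ℕ) (c R : ℕ → ℝ) (Rstar γ : ℝ) : Prop :=
    ∃ (ε' : ℝ) (M : ℕ) (πs : Fin M → DLC) (w : Fin M → ℝ) (T : ℝ),
      0 < ε' ∧
      (∀ i, (πs i).Valid n c R) ∧
      (∀ i, (πs i).Tsum (πs i).K = T) ∧
      (∀ i, 0 ≤ w i) ∧ (∑ i, w i = 1) ∧
      ∀ t ∈ Set.Icc (T / γ) T,
        (1 + ε') * Rstar * t ≤ ∑ i, w i * (πs i).cumUtil R t

lemma det {n : ℕ} {c R : ℕ → ℝ} {Rstar γ : ℝ} (hR : 0 < Rstar) {π : DLC}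
    (hv : π.Valid n c R) {d : ℝ} (hd : 0 < d)
    (h : ∀ t, π.Tsum π.K / γ ≤ t → t ≤ π.Tsum π.K → Rstar * t + d ≤ π.cumUtil R t) :
    Goal n c R Rstar γ := by
  have hT := tsum_pos hv hv.1 le_rfl
  refine ⟨d / (Rstar * π.Tsum π.K), 1, fun _ => π, fun _ => 1, π.Tsum π.K, by positivity,
    fun _ => hv, fun _ => rfl, fun _ => zero_le_one, by simp, ?_⟩
  rintro t ⟨h1, h2⟩
  simp only [Finset.univ_unique, one_mul, Finset.sum_const, Finset.card_singleton, one_smul]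
  refine le_trans ?_ (h t h1 h2)
  have e : (1 + d / (Rstar * π.Tsum π.K)) * Rstar * t = Rstar * t + d * (t / π.Tsum π.K) := by
    field_simp
  rw [e]
  have : t / π.Tsum π.K ≤ 1 := (div_le_one hT).2 h2
  nlinarith

/-- Case `m = 1`: fall to action 1. -/
lemma fall_to_one {n : ℕ} {c R : ℕ → ℝ} (h : LinInstance n c R) :
    ∀ i, ∀ π : DLC, π.Valid n c R → R 1 * π.Tsum π.K < π.cumUtil R (π.Tsum π.K) →
      1 ≤ i → i ∈ BR n c R (π.Asum π.K / π.Tsum π.K) →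
      ∃ π' : DLC, π'.Valid n c R ∧ R 1 * π'.Tsum π'.K < π'.cumUtil R (π'.Tsum π'.K) ∧
        1 ∈ BR n c R (π'.Asum π'.K / π'.Tsum π'.K) := by
  intro i
  induction i with
  | zero => intro π _ _ h1; omega
  | succ i ih =>
    intro π hv hu _ hb
    rcases Nat.eq_zero_or_pos i with h0 | h0
    · subst h0
      exact ⟨π, hv, hu, hb⟩
    have hin : i + 1 ≤ n := (Finset.mem_Icc.1 hb.1).2
    have hT := tsum_pos hv hv.1 le_rfl
    have hlow := br_lower h hb (by omega)
    simp only [Nat.add_sub_cancel] at hlow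
    have hIp := Ipos h (i := i) h0 (by omega)
    have hbi : ∀ x, x = indiff c R i → i ∈ BR n c R x ∧ i + 1 ∈ BR n c R x := by
      rintro x rfl
      refine ⟨br_suff h h0 (by omega) (fun h2 => Imono h (by omega) (by omega) (by omega))
        (fun _ => le_rfl), br_suff h (by omega) hin (fun _ => le_rfl)
        (fun h2 => Imono h (by omega) (by omega) (by omega))⟩
    rcases hlow.eq_or_lt with he | hl
    · exact ih π hv hu h0 (hbi _ he.symm).1
    · rw [lt_div_iff₀ hT] at hl
      have hτ : 0 < π.Asum π.K / indiff c R i - π.Tsum π.K := by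
        rw [sub_pos, lt_div_iff₀ hIp]
        linarith
      have hAp : 0 < π.Asum π.K := by nlinarith
      have hnew : (π.Asum π.K + 0 * (π.Asum π.K / indiff c R i - π.Tsum π.K)) /
          (π.Tsum π.K + (π.Asum π.K / indiff c R i - π.Tsum π.K)) = indiff c R i := by
        rw [zero_mul, add_zero, add_sub_cancel]
        field_simp
      obtain ⟨π', hv', hT', hA', -, hc⟩ := ext hv le_rfl hτ hb (hbi _ hnew).2
      refine ih π' hv' ?_ h0 ?_
      · rw [hT', hc _ (by linarith) le_rfl]
        have := Rmono h (i := 1) (j := i + 1) le_rfl (by omega) hin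
        nlinarith
      · rw [hT', hA']
        exact (hbi _ hnew).1

lemma caseB {n : ℕ} {c R : ℕ → ℝ} (h : LinInstance n c R) {γ : ℝ} (hγ : 1 < γ)
    (hR : 0 < R 1) (π : DLC) (hv : π.Valid n c R)
    (hu : R 1 * π.Tsum π.K < π.cumUtil R (π.Tsum π.K)) :
    Goal n c R (R 1) γ := by
  obtain ⟨π₁, hv₁, hu₁, hb₁⟩ := fall_to_one h (π.a π.K) π hv hu
    (Finset.mem_Icc.1 (hv.2.1 π.K (Finset.mem_Icc.2 ⟨hv.1, le_rfl⟩)).2.2).1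
    (hv.2.2.1 π.K (Finset.mem_Icc.2 ⟨hv.1, le_rfl⟩))
  have hT := tsum_pos hv₁ hv₁.1 le_rfl
  have hA := asum_nonneg hv₁
  have hτ : 0 < (γ - 1) * π₁.Tsum π₁.K := mul_pos (by linarith) hT
  have hb' : 1 ∈ BR n c R ((π₁.Asum π₁.K + 0 * ((γ - 1) * π₁.Tsum π₁.K)) /
      (π₁.Tsum π₁.K + (γ - 1) * π₁.Tsum π₁.K)) := by
    apply br_suff h le_rfl (by have := h.1; omega) (fun h2 => by omega)
    intro h1
    refine le_trans ?_ (br_upper h hb₁ h1)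
    rw [zero_mul, add_zero]
    exact div_le_div_of_nonneg_left hA hT (by linarith)
  obtain ⟨π', hv', hT', hA', -, hc⟩ := ext hv₁ le_rfl hτ hb₁ hb'
  apply det hR hv' (d := π₁.cumUtil R (π₁.Tsum π₁.K) - R 1 * π₁.Tsum π₁.K) (by linarith)
  intro t h1 h2
  rw [hT'] at h1 h2
  have : (π₁.Tsum π₁.K + (γ - 1) * π₁.Tsum π₁.K) / γ = π₁.Tsum π₁.K := by
    field_simp
    ring
  rw [this] at h1
  rw [hc t h1 h2]
  linarith

/-- Case of a higher-welfare action above `m`. -/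
lemma caseA {n : ℕ} {c R : ℕ → ℝ} (h : LinInstance n c R) {γ : ℝ} (hγ : 1 < γ) {m : ℕ}
    (hm : 2 ≤ m) (hmn : m < n) (hy : indiff c R m < 1)
    (hR : 0 < (1 - indiff c R (m - 1)) * R m) :
    Goal n c R ((1 - indiff c R (m - 1)) * R m) γ := by
  obtain ⟨k, rfl⟩ : ∃ k, m = k + 1 := ⟨m - 1, by omega⟩
  simp only [Nat.add_sub_cancel] at hR ⊢
  have hxp := Ipos h (i := k) (by omega) (by omega)
  have hxy := h.2.2.2.2.2.2.1 k (by omega) (by omega)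
  have hRR := h.2.2.2.2.1 (k + 1) (by omega) (by omega)
  have hbx : ∀ z, z = indiff c R k → k + 1 ∈ BR n c R z := by
    rintro z rfl
    exact br_suff h (by omega) (by omega) (fun _ => le_rfl) (fun _ => hxy.le)
  have hby : ∀ z, z = indiff c R (k + 1) → k + 1 ∈ BR n c R z := by
    rintro z rfl
    exact br_suff h (by omega) (by omega) (fun _ => hxy.le) (fun _ => le_rfl)
  have hby' : k + 1 + 1 ∈ BR n c R (indiff c R (k + 1)) :=
    br_suff h (by omega) (by omega) (fun _ => le_rfl)
      (fun h2 => Imono h (by omega) (by omega) (by omega))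
  generalize indiff c R k = x at *
  generalize indiff c R (k + 1) = y at *
  obtain ⟨π₁, hv₁, hT₁, hA₁, hc₁⟩ := single (by linarith) one_pos hby'
  have hT : 1 < y / x := by rwa [one_lt_div hxp]
  obtain ⟨π₂, hv₂, hT₂, hA₂, -, hc₂⟩ := ext hv₁ (x := 0) (τ := y / x - 1) le_rfl (by linarith)
    (hby _ (by rw [hT₁, hA₁]; simp)) (hbx _ (by
      have hyp : 0 < y := by linarith
      rw [hT₁, hA₁, zero_mul, add_zero, mul_one, add_sub_cancel]
      field_simp))
  rw [hT₁, add_sub_cancel] at hT₂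
  rw [hA₁, zero_mul, add_zero, mul_one] at hA₂
  have hyp : 0 < y := by linarith
  obtain ⟨π₃, hv₃, hT₃, hA₃, -, hc₃⟩ := ext hv₂ (x := x) (τ := (γ - 1) * (y / x)) hxp.le
    (mul_pos (by linarith) (by linarith))
    (hbx _ (by rw [hT₂, hA₂]; field_simp)) (hbx _ (by
      rw [hT₂, hA₂]
      field_simp
      rw [add_sub_cancel]
      exact div_self (by linarith)))
  apply det hR hv₃ (d := (1 - y) * (R (k + 1 + 1) - R (k + 1)))
    (mul_pos (by linarith) (by linarith))
  intro t h1 h2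
  rw [hT₃] at h1 h2
  rw [hT₂] at h1 h2
  have : (y / x + (γ - 1) * (y / x)) / γ = y / x := by
    field_simp
    ring
  rw [this] at h1
  rw [hc₃ t (by rw [hT₂]; exact h1) (by rw [hT₂]; exact h2), hT₂,
    hc₂ _ (by rw [hT₁]; linarith) (by rw [hT₁]; linarith), hT₁, hc₁ 1 zero_le_one le_rfl]
  have e : y / x * x = y := by field_simp
  generalize y / x = r at *
  subst e
  apply le_of_eq
  ring

/-- One member of the family in case `R (m-1) > R⋆`. -/
lemma caseC_member {n : ℕ} {c R : ℕ → ℝ} (h : LinInstance n c R) {m : ℕ}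
    (hm : 2 ≤ m) (hmn : m ≤ n)
    (hR : 0 < (1 - indiff c R (m - 1)) * R m) :
    ∃ ρ : ℝ, 1 < ρ ∧ ∀ S T : ℝ, 0 < S → S * ρ ≤ T →
      ∃ π : DLC, π.Valid n c R ∧ π.Tsum π.K = T ∧
        (∀ t, 0 ≤ t → t ≤ S → π.cumUtil R t = (1 - indiff c R (m - 1)) * R m * t) ∧
        (∀ t, S ≤ t → t ≤ S * ρ → π.cumUtil R t =
          (1 - indiff c R (m - 1)) * R m * t +
            (t - S) * (R (m - 1) - (1 - indiff c R (m - 1)) * R m)) ∧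
        (∀ t, S * ρ ≤ t → t ≤ T → 0 ≤ π.cumUtil R t) := by
  obtain ⟨k, rfl⟩ : ∃ k, m = k + 1 := ⟨m - 1, by omega⟩
  simp only [Nat.add_sub_cancel] at hR ⊢
  have hxp := Ipos h (i := k) (by omega) (by omega)
  have hx1 := Ile h (i := k) (by omega) (by omega)
  have hRk := Rnonneg h (i := k) (by omega) (by omega)
  have hbx : k + 1 ∈ BR n c R (indiff c R k) :=
    br_suff h (by omega) (by omega) (fun _ => le_rfl)
      (fun h2 => Imono h (by omega) (by omega) (by omega))
  obtain ⟨z, hz0, hzx, hbz⟩ : ∃ z, 0 < z ∧ z < indiff c R k ∧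
      ∀ w, z ≤ w → w ≤ indiff c R k → k ∈ BR n c R w := by
    by_cases hk : 2 ≤ k
    · refine ⟨(indiff c R (k - 1) + indiff c R k) / 2, ?_, ?_, ?_⟩
      · have := Ipos h (i := k - 1) (by omega) (by omega)
        linarith
      · have := h.2.2.2.2.2.2.1 (k - 1) (by omega) (by omega)
        rw [show k - 1 + 1 = k by omega] at this
        linarith
      · intro w h1 h2
        have := h.2.2.2.2.2.2.1 (k - 1) (by omega) (by omega)
        rw [show k - 1 + 1 = k by omega] at this
        exact br_suff h (by omega) (by omega) (fun _ => by linarith) (fun _ => h2)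
    · refine ⟨indiff c R k / 2, by linarith, by linarith, ?_⟩
      intro w h1 h2
      exact br_suff h (by omega) (by omega) (fun _ => by omega) (fun _ => h2)
  generalize indiff c R k = x at *
  refine ⟨x / z, by rwa [one_lt_div hz0], ?_⟩
  intro S T hS hST
  have hρ : 1 < x / z := by rwa [one_lt_div hz0]
  have hSρ : S < S * (x / z) := by nlinarith
  obtain ⟨π₁, hv₁, hT₁, hA₁, hc₁⟩ := single hxp.le hS hbx
  have e1 : π₁.Asum π₁.K / π₁.Tsum π₁.K = x := by rw [hT₁, hA₁]; field_simp
  have e2 : (π₁.Asum π₁.K + 0 * (S * (x / z) - S)) / (π₁.Tsum π₁.K + (S * (x / z) - S)) = z := by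
    rw [hT₁, hA₁, zero_mul, add_zero, add_sub_cancel]; field_simp
  obtain ⟨π₂, hv₂, hT₂, hA₂, hl₂, hc₂⟩ := ext hv₁ (x := 0) (τ := S * (x / z) - S) (b := k) le_rfl
    (by linarith) (by rw [e1]; exact hbz _ hzx.le le_rfl) (by rw [e2]; exact hbz _ le_rfl hzx.le)
  rw [hT₁, add_sub_cancel] at hT₂
  rw [hA₁, zero_mul, add_zero] at hA₂
  rw [hT₁] at hl₂ hc₂
  rw [add_sub_cancel] at hc₂
  have p1 : ∀ t, 0 ≤ t → t ≤ S → π₂.cumUtil R t = (1 - x) * R (k + 1) * t := by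
    intro t h1 h2
    rw [hl₂ t h2, hc₁ t h1 h2]
    ring
  have p2 : ∀ t, S ≤ t → t ≤ S * (x / z) → π₂.cumUtil R t =
      (1 - x) * R (k + 1) * t + (t - S) * (R k - (1 - x) * R (k + 1)) := by
    intro t h1 h2
    rw [hc₂ t h1 h2, hc₁ S hS.le le_rfl]
    ring
  have p3 : 0 ≤ π₂.cumUtil R (S * (x / z)) := by
    rw [hc₂ _ hSρ.le le_rfl, hc₁ S hS.le le_rfl]
    have := mul_nonneg (sub_nonneg.2 hSρ.le) hRk
    nlinarith
  rcases hST.eq_or_lt with he | hl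
  · refine ⟨π₂, hv₂, by rw [hT₂, he], p1, p2, ?_⟩
    intro t h1 h2
    obtain rfl : t = S * (x / z) := by linarith
    exact p3
  · have e1 : π₂.Asum π₂.K / π₂.Tsum π₂.K = z := by rw [hT₂, hA₂]; field_simp
    have e2 : (π₂.Asum π₂.K + z * (T - S * (x / z))) / (π₂.Tsum π₂.K + (T - S * (x / z))) = z := by
      have : 0 < T := by linarith
      rw [hT₂, hA₂, add_sub_cancel]
      field_simp
      ring
    obtain ⟨π₃, hv₃, hT₃, hA₃, hl₃, hc₃⟩ := ext hv₂ (x := z) (τ := T - S * (x / z)) (b := k)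
      hz0.le (by linarith) (by rw [e1]; exact hbz _ le_rfl hzx.le)
      (by rw [e2]; exact hbz _ le_rfl hzx.le)
    rw [hT₂, add_sub_cancel] at hT₃
    rw [hT₂] at hl₃ hc₃
    rw [add_sub_cancel] at hc₃
    refine ⟨π₃, hv₃, hT₃, ?_, ?_, ?_⟩
    · intro t h1 h2
      rw [hl₃ t (by linarith), p1 t h1 h2]
    · intro t h1 h2
      rw [hl₃ t h2, p2 t h1 h2]
    · intro t h1 h2
      rw [hc₃ t h1 h2]
      have := mul_nonneg (mul_nonneg (sub_nonneg.2 h1) (by linarith : 0 ≤ 1 - z)) hRk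
      linarith

lemma mixture {n : ℕ} {c R : ℕ → ℝ} {Rs γ κ ρ : ℝ} (hR : 0 < Rs) (hγ : 1 < γ) (hκ : 0 < κ)
    (hρ : 1 < ρ)
    (H : ∀ S T : ℝ, 0 < S → S * ρ ≤ T →
      ∃ π : DLC, π.Valid n c R ∧ π.Tsum π.K = T ∧
        (∀ t, 0 ≤ t → t ≤ S → π.cumUtil R t = Rs * t) ∧
        (∀ t, S ≤ t → t ≤ S * ρ → π.cumUtil R t = Rs * t + (t - S) * κ) ∧
        (∀ t, S * ρ ≤ t → t ≤ T → 0 ≤ π.cumUtil R t)) :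
    Goal n c R Rs γ := by
  obtain ⟨q, hq1, hq⟩ : ∃ q : ℝ, 1 < q ∧ q ^ 2 = ρ :=
    ⟨√ρ, by rw [Real.lt_sqrt zero_le_one]; simpa using hρ, Real.sq_sqrt (by linarith)⟩
  have hq0 : 0 < q := by linarith
  obtain ⟨M, hM⟩ := pow_unbounded_of_one_lt γ hq1
  have hM0 : M ≠ 0 := by
    rintro rfl
    simp at hM
    linarith
  have hmem : ∀ i : Fin M, q ^ (i : ℕ) * ρ ≤ q ^ (M + 1) := by
    intro i
    rw [← hq, ← pow_add]
    exact pow_le_pow_right₀ hq1.le (by omega)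
  choose πs hv hT h1 h2 h3 using fun i : Fin M =>
    H (q ^ (i : ℕ)) (q ^ (M + 1)) (pow_pos hq0 _) (hmem i)
  obtain ⟨δ, hδ⟩ : ∃ δ, δ = (1 - 1 / q) * κ := ⟨_, rfl⟩
  have hδ0 : 0 < δ := by
    rw [hδ]
    apply mul_pos _ hκ
    rw [sub_pos, div_lt_one hq0]
    exact hq1
  obtain ⟨b, hb⟩ : ∃ b, b = 1 + 2 * Rs / δ := ⟨_, rfl⟩
  have hb1 : 1 < b := by
    rw [hb]
    have : 0 < 2 * Rs / δ := by positivity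
    linarith
  have hb0 : 0 < b := by linarith
  obtain ⟨W, hW⟩ : ∃ W, W = ∑ i : Fin M, b ^ (i : ℕ) := ⟨_, rfl⟩
  have hW0 : 0 < W := by
    rw [hW]
    apply Finset.sum_pos
    · intro i _; positivity
    · exact ⟨⟨0, by omega⟩, Finset.mem_univ _⟩
  -- the key estimate
  have key : ∀ t, q ≤ t → t ≤ q ^ (M + 1) →
      δ / 2 * t ≤ ∑ i : Fin M, b ^ (i : ℕ) * ((πs i).cumUtil R t - Rs * t) := by
    intro t ht1 ht2
    have ht0 : 0 < t := by linarith
    obtain ⟨i, hiM, hi1, hi2⟩ : ∃ i, i < M ∧ q ^ (i + 1) ≤ t ∧ t ≤ q ^ (i + 2) := by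
      have hex : ∃ i, t ≤ q ^ (i + 2) := ⟨M - 1, by rwa [show M - 1 + 2 = M + 1 by omega]⟩
      classical
      refine ⟨Nat.find hex, ?_, ?_, Nat.find_spec hex⟩
      · have := Nat.find_min' hex (m := M - 1) (by rwa [show M - 1 + 2 = M + 1 by omega])
        omega
      · rcases Nat.eq_zero_or_pos (Nat.find hex) with h0 | h0
        · rw [h0]; simpa using ht1
        · have := Nat.find_min hex (m := Nat.find hex - 1) (by omega)
          rw [show Nat.find hex - 1 + 2 = Nat.find hex + 1 by omega] at this
          exact (not_le.1 this).le
    have hpt : ∀ j : Fin M, (if (j : ℕ) = i then b ^ i * δ * t else 0) -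
        (if (j : ℕ) < i then b ^ (j : ℕ) * Rs * t else 0) ≤
        b ^ (j : ℕ) * ((πs j).cumUtil R t - Rs * t) := by
      intro j
      have hbj : 0 < b ^ (j : ℕ) := by positivity
      have hρj : q ^ (j : ℕ) * ρ = q ^ ((j : ℕ) + 2) := by rw [← hq, ← pow_add]
      rcases lt_trichotomy (j : ℕ) i with hlt | heq | hgt
      · rw [if_neg hlt.ne, if_pos hlt]
        have : 0 ≤ (πs j).cumUtil R t := by
          rcases le_total t (q ^ (j : ℕ)) with hh | hh
          · rw [h1 j t ht0.le hh]; positivity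
          rcases le_total t (q ^ (j : ℕ) * ρ) with hh2 | hh2
          · rw [h2 j t hh hh2]
            have := mul_nonneg (sub_nonneg.2 hh) hκ.le
            have : 0 < Rs * t := by positivity
            linarith
          · exact h3 j t hh2 ht2
        have := mul_nonneg hbj.le this
        linarith
      · rw [if_pos heq, if_neg (by omega), sub_zero, ← heq]
        rw [h2 j t ?_ ?_]
        · have e : q ^ (j : ℕ) ≤ t / q := by
            rw [le_div_iff₀ hq0, ← pow_succ, heq]
            exact hi1
          have : δ * t ≤ (t - q ^ (j : ℕ)) * κ := by
            rw [hδ]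
            have : (1 - 1 / q) * κ * t = (t - t / q) * κ := by ring
            rw [this]
            apply mul_le_mul_of_nonneg_right _ hκ.le
            linarith
          rw [mul_assoc]
          apply mul_le_mul_of_nonneg_left _ hbj.le
          linarith
        · refine le_trans ?_ hi1
          exact pow_le_pow_right₀ hq1.le (by omega)
        · rw [hρj, heq]; exact hi2
      · rw [if_neg hgt.ne', if_neg (by omega), sub_zero]
        apply mul_nonneg hbj.le
        rcases le_total t (q ^ (j : ℕ)) with hh | hh
        · rw [h1 j t ht0.le hh]; linarith
        · rw [h2 j t hh ?_]
          · have := mul_nonneg (sub_nonneg.2 hh) hκ.le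
            linarith
          · rw [hρj]
            exact le_trans hi2 (pow_le_pow_right₀ hq1.le (by omega))
    refine le_trans ?_ (Finset.sum_le_sum (fun j _ => hpt j))
    rw [Finset.sum_sub_distrib]
    have s1 : ∑ j : Fin M, (if (j : ℕ) = i then b ^ i * δ * t else 0) = b ^ i * δ * t := by
      rw [Fin.sum_univ_eq_sum_range (fun j => if j = i then b ^ i * δ * t else 0) M]
      rw [Finset.sum_ite_eq' (Finset.range M) i, if_pos (Finset.mem_range.2 hiM)]
    have s2 : ∑ j : Fin M, (if (j : ℕ) < i then b ^ (j : ℕ) * Rs * t else 0) =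
        (∑ j ∈ Finset.range i, b ^ j) * Rs * t := by
      rw [Fin.sum_univ_eq_sum_range (fun j => if j < i then b ^ j * Rs * t else 0) M]
      rw [← Finset.sum_filter, Finset.sum_mul, Finset.sum_mul]
      apply Finset.sum_congr _ (fun _ _ => rfl)
      ext j
      simp only [Finset.mem_filter, Finset.mem_range]
      omega
    rw [s1, s2, geom_sum_eq hb1.ne']
    have e3 : b - 1 = 2 * Rs / δ := by rw [hb]; ring
    have e4 : (b ^ i - 1) / (b - 1) * Rs = (b ^ i - 1) * δ / 2 := by
      rw [e3]; field_simp
    rw [e4]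
    have e5 : 1 ≤ b ^ i := one_le_pow₀ hb1.le
    have : 0 < δ * t := by positivity
    nlinarith
  refine ⟨δ / (2 * W * Rs), M, πs, fun i => b ^ (i : ℕ) / W, q ^ (M + 1), by positivity, hv, hT,
    fun i => by positivity, ?_, ?_⟩
  · rw [← Finset.sum_div, ← hW, div_self hW0.ne']
  · rintro t ⟨ht1, ht2⟩
    have hqt : q ≤ t := by
      refine le_trans ?_ ht1
      rw [le_div_iff₀ (by linarith), pow_succ']
      exact mul_le_mul_of_nonneg_left hM.le hq0.le
    have k := key t hqt ht2
    have e : ∑ i : Fin M, b ^ (i : ℕ) / W * (πs i).cumUtil R t =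
        (∑ i : Fin M, b ^ (i : ℕ) * ((πs i).cumUtil R t - Rs * t)) / W + Rs * t := by
      simp only [mul_sub, Finset.sum_sub_distrib, ← Finset.sum_mul]
      rw [← hW, sub_div, mul_comm W, mul_div_assoc, div_self hW0.ne', Finset.sum_div]
      simp only [div_mul_eq_mul_div]
      ring
    rw [e]
    have : (1 + δ / (2 * W * Rs)) * Rs * t = δ / 2 * t / W + Rs * t := by
      field_simp
      ring
    rw [this]
    have := div_le_div_of_nonneg_right k hW0.le
    linarith

/-- Upper bound when `R (m-1) ≤ R⋆` and action `m` has maximal welfare. -/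
lemma upper {n : ℕ} {c R : ℕ → ℝ} (h : LinInstance n c R) {m : ℕ}
    (hm : 2 ≤ m) (hmn : m ≤ n)
    (hle : R (m - 1) ≤ (1 - indiff c R (m - 1)) * R m)
    (hW : ∀ a, 1 ≤ a → a ≤ n → R a - c a ≤ R m - c m) {π : DLC} (hv : π.Valid n c R) :
    ∀ k ≤ π.K, ∑ j ∈ Finset.Icc 1 k, π.τ j * (1 - π.α j) * R (π.a j) ≤
      (1 - indiff c R (m - 1)) * R m * π.Tsum k := by
  -- agent utility bound
  have agent : ∀ k ≤ π.K, ∀ b, 1 ≤ b → b ≤ n → π.Asum k * R b - π.Tsum k * c b ≤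
      ∑ j ∈ Finset.Icc 1 k, π.τ j * (π.α j * R (π.a j) - c (π.a j)) := by
    intro k
    induction k with
    | zero => intro _ b _ _; simp [DLC.Asum, DLC.Tsum]
    | succ k ih =>
      intro hk b hb1 hb2
      have hmem : k + 1 ∈ Finset.Icc 1 π.K := Finset.mem_Icc.2 ⟨by omega, hk⟩
      have ha := Finset.mem_Icc.1 (hv.2.1 _ hmem).2.2
      have h1 := ih (by omega) (π.a (k + 1)) ha.1 ha.2
      have h2 := (hv.2.2.1 _ hmem).2 b (Finset.mem_Icc.2 ⟨hb1, hb2⟩)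
      have hTp := tsum_pos hv (by omega) hk
      have h3 := mul_le_mul_of_nonneg_left h2 hTp.le
      have e : π.Tsum (k + 1) * π.avg (k + 1) = π.Asum (k + 1) := by
        unfold DLC.avg
        field_simp
      rw [mul_sub, mul_sub, ← mul_assoc, ← mul_assoc, e] at h3
      rw [Finset.sum_Icc_succ_top (by omega)]
      have e1 := tsum_succ π k
      have e2 := asum_succ π k
      refine le_trans h3 ?_
      rw [e1, e2]
      linarith
  have welf : ∀ k ≤ π.K, ∑ j ∈ Finset.Icc 1 k, π.τ j * (R (π.a j) - c (π.a j)) ≤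
      π.Tsum k * (R m - c m) := by
    intro k hk
    unfold DLC.Tsum
    rw [Finset.sum_mul]
    apply Finset.sum_le_sum
    intro j hj
    rw [Finset.mem_Icc] at hj
    have hh := hv.2.1 j (Finset.mem_Icc.2 ⟨hj.1, by omega⟩)
    have ha := Finset.mem_Icc.1 hh.2.2
    exact mul_le_mul_of_nonneg_left (hW _ ha.1 ha.2) hh.2.1.le
  intro k
  induction k with
  | zero => intro _; simp [DLC.Tsum]
  | succ k ih =>
    intro hk
    have hmem : k + 1 ∈ Finset.Icc 1 π.K := Finset.mem_Icc.2 ⟨by omega, hk⟩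
    have hTp := tsum_pos hv (by omega) hk
    rcases le_or_gt (indiff c R (m - 1)) (π.avg (k + 1)) with hge | hlt
    · have h1 := agent (k + 1) hk m (by omega) hmn
      have h2 := welf (k + 1) hk
      have e : ∑ j ∈ Finset.Icc 1 (k + 1), π.τ j * (1 - π.α j) * R (π.a j) =
          ∑ j ∈ Finset.Icc 1 (k + 1), π.τ j * (R (π.a j) - c (π.a j)) -
          ∑ j ∈ Finset.Icc 1 (k + 1), π.τ j * (π.α j * R (π.a j) - c (π.a j)) := by
        rw [← Finset.sum_sub_distrib]
        apply Finset.sum_congr rfl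
        intro j _
        ring
      rw [e]
      have h3 : indiff c R (m - 1) * π.Tsum (k + 1) ≤ π.Asum (k + 1) := by
        unfold DLC.avg at hge
        rwa [le_div_iff₀ hTp] at hge
      have h4 := mul_le_mul_of_nonneg_right h3 (Rnonneg h (by omega) hmn)
      linarith
    · have h1 := ih (by omega)
      rw [Finset.sum_Icc_succ_top (by omega), tsum_succ]
      have hh := hv.2.1 _ hmem
      have ha := Finset.mem_Icc.1 hh.2.2
      have ham : π.a (k + 1) ≤ m - 1 := by
        by_contra hc
        have l1 := br_lower h (hv.2.2.1 _ hmem) (by omega)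
        have l2 := Imono h (i := m - 1) (j := π.a (k + 1) - 1) (by omega) (by omega) (by omega)
        linarith
      have hRa := Rmono h ha.1 ham (by omega)
      have hRa0 := Rnonneg h ha.1 ha.2
      have : (1 - π.α (k + 1)) * R (π.a (k + 1)) ≤ (1 - indiff c R (m - 1)) * R m := by
        have := mul_nonneg hh.1 hRa0
        linarith
      have := mul_le_mul_of_nonneg_left this hh.2.1.le
      linarith

/-- If the next indifference point is `≥ 1`, action `m` has maximal welfare. -/
lemma maxwelf {n : ℕ} {c R : ℕ → ℝ} (h : LinInstance n c R) {m : ℕ}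
    (hm : 1 ≤ m) (hmn : m ≤ n) (hy : m < n → 1 ≤ indiff c R m) :
    ∀ a, 1 ≤ a → a ≤ n → R a - c a ≤ R m - c m := by
  have : m ∈ BR n c R 1 := br_suff h hm hmn (fun _ => Ile h (by omega) (by omega)) hy
  intro a h1 h2
  have := this.2 a (Finset.mem_Icc.2 ⟨h1, h2⟩)
  linarith

end RAUU

/-- If some valid dynamic linear contract strictly beats the
optimal static utility `R⋆`, then for every `γ > 1` there exist `ε' > 0` and a
finite mixture of valid dynamic linear contracts of common total duration `T`
whose expected cumulative principal utility is at least `(1+ε')·R⋆·t` for every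
`t ∈ [T/γ, T]`. -/
theorem randomized_advantage_under_uncertainty (n : ℕ) (c R : ℕ → ℝ)
    (hInst : LinInstance n c R) (Rstar : ℝ)
    (hRstar : IsGreatest ((fun i => (1 - bp c R (i - 1)) * R i) '' Set.Icc 1 n) Rstar)
    (hRpos : 0 < Rstar)
    (π₀ : DLC) (h₀ : π₀.Valid n c R) (hbeats : π₀.Util R > Rstar)
    (γ : ℝ) (hγ : 1 < γ) :
    ∃ (ε' : ℝ) (M : ℕ) (πs : Fin M → DLC) (w : Fin M → ℝ) (T : ℝ),
      0 < ε' ∧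
      (∀ i, (πs i).Valid n c R) ∧
      (∀ i, (πs i).Tsum (πs i).K = T) ∧
      (∀ i, 0 ≤ w i) ∧ (∑ i, w i = 1) ∧
      ∀ t ∈ Set.Icc (T / γ) T,
        (1 + ε') * Rstar * t ≤ ∑ i, w i * (πs i).cumUtil R t := by
  obtain ⟨⟨m, ⟨hm1, hmn⟩, hm⟩, -⟩ := hRstar
  simp only at hm
  have hT := RAUU.tsum_pos h₀ h₀.1 le_rfl
  have hu : Rstar * π₀.Tsum π₀.K <
      ∑ k ∈ Finset.Icc 1 π₀.K, π₀.τ k * (1 - π₀.α k) * R (π₀.a k) := by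
    unfold DLC.Util at hbeats
    rwa [gt_iff_lt, lt_div_iff₀ hT] at hbeats
  change RAUU.Goal n c R Rstar γ
  rcases hm1.eq_or_lt with h1 | h2
  · subst h1
    simp [bp] at hm
    subst hm
    exact RAUU.caseB hInst hγ hRpos π₀ h₀ (by rw [RAUU.cum_stable h₀ le_rfl]; exact hu)
  · have hbp : bp c R (m - 1) = indiff c R (m - 1) := by
      unfold bp
      rw [if_neg (by omega)]
    rw [hbp] at hm
    subst hm
    rcases lt_or_ge ((1 - indiff c R (m - 1)) * R m) (R (m - 1)) with hlt | hge
    · obtain ⟨ρ, hρ, H⟩ := RAUU.caseC_member hInst h2 hmn hRpos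
      exact RAUU.mixture hRpos hγ (sub_pos.2 hlt) hρ H
    · by_cases hy : m < n ∧ indiff c R m < 1
      · exact RAUU.caseA hInst hγ h2 hy.1 hy.2 hRpos
      · exfalso
        have hW := RAUU.maxwelf hInst hm1 hmn
          (fun hh => by by_contra hc; exact hy ⟨hh, not_le.1 hc⟩)
        have := RAUU.upper hInst h2 hmn hge hW h₀ π₀.K le_rfl
        linarith
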